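/- Let Z be an asymmetric partition with representation Z', and let 𝒮ₙ = (X₁, …, Xₙ) be a sample of partitions with Xᵢ ∈ A_Z for all i. For each i choose a representation Xᵢ' ∈ Xᵢ in optimal position with Z'. Then the multiple alignment 𝔛 = (X₁', …, Xₙ') is an optimal multiple alignment of 𝒮ₙ (it globally minimizes fₙ), the partition M = π((1/n) Σᵢ Xᵢ') is a mean partition of 𝒮ₙ, and M ∈ A_Z. -/

import Mathlib

/-!
Partition spaces for consensus clustering (Jain, "Condorcet's Jury Theorem for
Consensus Clustering").  Labeled partitions are ℓ×m column-stochastic matrices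
with entries in [0,1]; the group Π of ℓ×ℓ permutation matrices acts by left
multiplication; partitions are orbits; δ is induced by the Frobenius norm.
-/

namespace CJT

/-- ℓ×m real matrices. -/
abbrev Mat (l m : ℕ) := Matrix (Fin l) (Fin m) ℝ

/-- `P` is an ℓ×ℓ permutation matrix. -/
def IsPermMatrix {l : ℕ} (P : Matrix (Fin l) (Fin l) ℝ) : Prop :=
  ∃ σ : Equiv.Perm (Fin l), ∀ i k, P i k = if σ i = k then 1 else 0

/-- `X` is a labeled partition: entries in `[0,1]`, columns summing to one. -/
def IsLabeled {l m : ℕ} (X : Mat l m) : Prop :=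
  (∀ i j, 0 ≤ X i j ∧ X i j ≤ 1) ∧ ∀ j, (∑ i, X i j) = 1

/-- The orbit `[X] = {P X : P ∈ Π}` of a labeled partition. -/
def orbit {l m : ℕ} (X : Mat l m) : Set (Mat l m) :=
  {Y | ∃ P : Matrix (Fin l) (Fin l) ℝ, IsPermMatrix P ∧ Y = P * X}

/-- The partition space 𝒫: all orbits of labeled partitions. -/
def PartitionSpace (l m : ℕ) : Set (Set (Mat l m)) :=
  {A | ∃ X : Mat l m, IsLabeled X ∧ A = orbit X}

/-- Frobenius (Euclidean) norm. -/
noncomputable def frobNorm {l m : ℕ} (X : Mat l m) : ℝ :=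
  Real.sqrt (∑ i, ∑ j, (X i j) ^ 2)

/-- `δ(A, B) = min {‖X' − Y'‖ : X' ∈ A, Y' ∈ B}`. -/
noncomputable def pdist {l m : ℕ} (A B : Set (Mat l m)) : ℝ :=
  sInf {d | ∃ X ∈ A, ∃ Y ∈ B, d = frobNorm (X - Y)}

/-- The Fréchet function `Fₙ(Z) = (1/n) Σᵢ δ(Xᵢ, Z)²` of a sample
`𝒮ₙ = (X₁, …, Xₙ)` of `n` partitions. -/
noncomputable def frechet {l m n : ℕ} (s : Fin n → Set (Mat l m)) (A : Set (Mat l m)) : ℝ :=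
  (1 / (n : ℝ)) * ∑ i, (pdist (s i) A) ^ 2

/-- A mean partition of the sample `s`: a global minimizer of the Fréchet
function over the partition space 𝒫. -/
def IsMeanPartition {l m n : ℕ} (s : Fin n → Set (Mat l m)) (M : Set (Mat l m)) : Prop :=
  M ∈ PartitionSpace l m ∧ ∀ W ∈ PartitionSpace l m, frechet s M ≤ frechet s W

/-- A multiple alignment of the sample `s`: a choice of representations
`Xᵢ' ∈ Xᵢ`. -/
def IsAlignment {l m n : ℕ} (s : Fin n → Set (Mat l m)) (R : Fin n → Mat l m) : Prop :=
  ∀ i, R i ∈ s i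

/-- `fₙ(𝔛) = (1/n²) Σᵢ Σⱼ ‖Xᵢ' − Xⱼ'‖²`. -/
noncomputable def alignCost {l m n : ℕ} (R : Fin n → Mat l m) : ℝ :=
  (1 / (n : ℝ) ^ 2) * ∑ i, ∑ j, (frobNorm (R i - R j)) ^ 2

/-- An optimal multiple alignment: a global minimizer of `fₙ` over all multiple
alignments of the sample `s`. -/
def IsOptimalAlignment {l m n : ℕ} (s : Fin n → Set (Mat l m)) (R : Fin n → Mat l m) : Prop :=
  IsAlignment s R ∧ ∀ R' : Fin n → Mat l m, IsAlignment s R' → alignCost R ≤ alignCost R'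

/-- The mean `M_𝔛 = (1/n) Σᵢ Xᵢ'` of a multiple alignment. -/
noncomputable def alignMean {l m n : ℕ} (R : Fin n → Mat l m) : Mat l m :=
  ((n : ℝ)⁻¹) • ∑ i, R i

/-- The degree of asymmetry
`α_Z = min {‖Z' − P Z'‖ : Z' ∈ Z, P ∈ Π, P ≠ I}` of a partition `Z`. -/
noncomputable def asym {l m : ℕ} (A : Set (Mat l m)) : ℝ :=
  sInf {d | ∃ Z' ∈ A, ∃ P : Matrix (Fin l) (Fin l) ℝ,
    IsPermMatrix P ∧ P ≠ 1 ∧ d = frobNorm (Z' - P * Z')}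

section Frobenius

open scoped Matrix.Norms.Frobenius

variable {l m n : ℕ}

lemma frobNorm_eq_norm (X : Mat l m) : frobNorm X = ‖X‖ := by
  simp [frobNorm, Matrix.frobenius_norm_def, Real.sqrt_eq_rpow]

lemma frobNorm_nonneg (X : Mat l m) : 0 ≤ frobNorm X := Real.sqrt_nonneg _

lemma frobNorm_sq (X : Mat l m) : frobNorm X ^ 2 = ∑ i, ∑ j, X i j ^ 2 :=
  Real.sq_sqrt (Finset.sum_nonneg fun _ _ => Finset.sum_nonneg fun _ _ => sq_nonneg _)

lemma frobNorm_sub_comm (X Y : Mat l m) : frobNorm (X - Y) = frobNorm (Y - X) := by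
  simp only [frobNorm_eq_norm, norm_sub_rev]

lemma frobNorm_sub_le (X Y Z : Mat l m) :
    frobNorm (X - Z) ≤ frobNorm (X - Y) + frobNorm (Y - Z) := by
  simpa only [frobNorm_eq_norm] using norm_sub_le_norm_sub_add_norm_sub X Y Z

lemma frobNorm_submatrix_sub (X Y : Mat l m) (σ : Equiv.Perm (Fin l)) :
    frobNorm (X.submatrix σ id - Y.submatrix σ id) = frobNorm (X - Y) := by
  simp only [frobNorm, Matrix.sub_apply, Matrix.submatrix_apply, id]
  rw [Equiv.sum_comp σ fun i => ∑ j, (X i j - Y i j) ^ 2]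

lemma frobNorm_alignMean_sub_le (hn : 0 < n) (R : Fin n → Mat l m) (Z : Mat l m) {r : ℝ}
    (h : ∀ i, frobNorm (R i - Z) ≤ r) : frobNorm (alignMean R - Z) ≤ r := by
  have hn' : (0 : ℝ) < n := Nat.cast_pos.2 hn
  have hmean : alignMean R - Z = (n : ℝ)⁻¹ • ∑ i, (R i - Z) := by
    rw [alignMean, Finset.sum_sub_distrib, smul_sub]
    simp [← Nat.cast_smul_eq_nsmul ℝ, smul_smul, hn'.ne']
  have hsum : ‖∑ i, (R i - Z)‖ ≤ n * r := by
    refine (norm_sum_le _ _).trans ?_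
    simpa using Finset.sum_le_sum fun i (_ : i ∈ Finset.univ) =>
      (frobNorm_eq_norm (R i - Z)).ge.trans (h i)
  rw [hmean, frobNorm_eq_norm, norm_smul, norm_inv, Real.norm_natCast, inv_mul_le_iff₀ hn']
  exact hsum

end Frobenius

section Orbits

variable {l m : ℕ}

lemma mul_eq_submatrix {P : Matrix (Fin l) (Fin l) ℝ} {σ : Equiv.Perm (Fin l)}
    (hP : ∀ i k, P i k = if σ i = k then 1 else 0) (X : Mat l m) :
    P * X = X.submatrix σ id := by
  ext i j
  simp [Matrix.mul_apply, hP]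

lemma mem_orbit_iff {X Y : Mat l m} :
    Y ∈ orbit X ↔ ∃ σ : Equiv.Perm (Fin l), Y = X.submatrix σ id := by
  constructor
  · rintro ⟨P, ⟨σ, hσ⟩, rfl⟩
    exact ⟨σ, mul_eq_submatrix hσ X⟩
  · rintro ⟨σ, rfl⟩
    exact ⟨Matrix.of fun i k => if σ i = k then 1 else 0, ⟨σ, fun _ _ => rfl⟩,
      (mul_eq_submatrix (fun _ _ => rfl) X).symm⟩

lemma mem_orbit_self (X : Mat l m) : X ∈ orbit X :=
  mem_orbit_iff.2 ⟨1, rfl⟩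

lemma submatrix_mem {A : Set (Mat l m)} (hA : A ∈ PartitionSpace l m) {X : Mat l m}
    (hX : X ∈ A) (σ : Equiv.Perm (Fin l)) : X.submatrix σ id ∈ A := by
  obtain ⟨W, -, rfl⟩ := hA
  obtain ⟨τ, rfl⟩ := mem_orbit_iff.1 hX
  exact mem_orbit_iff.2 ⟨σ.trans τ, rfl⟩

lemma exists_submatrix_eq {A : Set (Mat l m)} (hA : A ∈ PartitionSpace l m) {X Y : Mat l m}
    (hX : X ∈ A) (hY : Y ∈ A) : ∃ σ : Equiv.Perm (Fin l), Y = X.submatrix σ id := by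
  obtain ⟨W, -, rfl⟩ := hA
  obtain ⟨σ, rfl⟩ := mem_orbit_iff.1 hX
  obtain ⟨τ, rfl⟩ := mem_orbit_iff.1 hY
  exact ⟨τ.trans σ.symm, by ext; simp⟩

lemma isLabeled_of_mem {A : Set (Mat l m)} (hA : A ∈ PartitionSpace l m) {X : Mat l m}
    (hX : X ∈ A) : IsLabeled X := by
  obtain ⟨W, hW, rfl⟩ := hA
  obtain ⟨σ, rfl⟩ := mem_orbit_iff.1 hX
  exact ⟨fun i j => hW.1 (σ i) j, fun j => (Equiv.sum_comp σ fun i => W i j).trans (hW.2 j)⟩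

lemma finite_of_mem_partitionSpace {A : Set (Mat l m)} (hA : A ∈ PartitionSpace l m) :
    A.Finite := by
  obtain ⟨W, -, rfl⟩ := hA
  refine (Set.finite_range fun σ : Equiv.Perm (Fin l) => W.submatrix σ id).subset fun Y hY => ?_
  obtain ⟨σ, rfl⟩ := mem_orbit_iff.1 hY
  exact ⟨σ, rfl⟩

lemma pdist_nonneg (A B : Set (Mat l m)) : 0 ≤ pdist A B := by
  refine Real.sInf_nonneg ?_
  rintro _ ⟨X, -, Y, -, rfl⟩
  exact frobNorm_nonneg _

lemma pdist_le {A B : Set (Mat l m)} {X Y : Mat l m} (hX : X ∈ A) (hY : Y ∈ B) :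
    pdist A B ≤ frobNorm (X - Y) := by
  refine csInf_le ⟨0, ?_⟩ ⟨X, hX, Y, hY, rfl⟩
  rintro _ ⟨X, -, Y, -, rfl⟩
  exact frobNorm_nonneg _

/-- Every representation of `B` is in optimal position with some representation of `A`. -/
lemma exists_optimal_position {A B : Set (Mat l m)} (hA : A ∈ PartitionSpace l m)
    (hB : B ∈ PartitionSpace l m) {W : Mat l m} (hW : W ∈ B) :
    ∃ X ∈ A, frobNorm (X - W) = pdist A B := by
  have hne : A.Nonempty := by
    obtain ⟨X, -, rfl⟩ := hA
    exact ⟨X, mem_orbit_self X⟩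
  have hfin : {d | ∃ X ∈ A, ∃ Y ∈ B, d = frobNorm (X - Y)}.Finite := by
    refine ((finite_of_mem_partitionSpace hA).image2 (fun X Y => frobNorm (X - Y))
      (finite_of_mem_partitionSpace hB)).subset ?_
    rintro _ ⟨X, hX, Y, hY, rfl⟩
    exact ⟨X, hX, Y, hY, rfl⟩
  obtain ⟨X₀, hX₀⟩ := hne
  have hdist : {d | ∃ X ∈ A, ∃ Y ∈ B, d = frobNorm (X - Y)}.Nonempty :=
    ⟨_, X₀, hX₀, W, hW, rfl⟩
  obtain ⟨X, hX, Y, hY, hd⟩ := hdist.csInf_mem hfin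
  obtain ⟨σ, rfl⟩ := exists_submatrix_eq hB hY hW
  exact ⟨X.submatrix σ id, submatrix_mem hA hX σ, (frobNorm_submatrix_sub X Y σ).trans hd.symm⟩

lemma asym_le {A : Set (Mat l m)} {Z : Mat l m} (hZ : Z ∈ A) {σ : Equiv.Perm (Fin l)}
    (hσ : σ ≠ 1) : asym A ≤ frobNorm (Z - Z.submatrix σ id) := by
  refine csInf_le ⟨0, ?_⟩ ⟨Z, hZ, Matrix.of fun i k => if σ i = k then 1 else 0,
    ⟨σ, fun _ _ => rfl⟩, fun h => hσ ?_, ?_⟩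
  · rintro _ ⟨X, -, P, -, -, rfl⟩
    exact frobNorm_nonneg _
  · ext i
    have hi := congrFun (congrFun h i) i
    simp only [Matrix.of_apply, Matrix.one_apply_eq] at hi
    by_contra hne
    rw [if_neg fun h' => hne (by simp [h'])] at hi
    exact zero_ne_one hi
  · exact congrArg (fun Y => frobNorm (Z - Y)) (mul_eq_submatrix (fun _ _ => rfl) Z).symm

/-- Representations close to an asymmetric representation are in optimal position. -/
lemma frobNorm_sub_le_submatrix {A : Set (Mat l m)} {Z X Y : Mat l m} (hZ : Z ∈ A)
    (hX : frobNorm (X - Z) ≤ asym A / 4) (hY : frobNorm (Y - Z) ≤ asym A / 4)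
    (σ : Equiv.Perm (Fin l)) : frobNorm (X - Y) ≤ frobNorm (X - Y.submatrix σ id) := by
  rcases eq_or_ne σ 1 with rfl | hσ
  · exact le_rfl
  · have hXY := frobNorm_sub_le X Z Y
    have hZσ := frobNorm_sub_le Z X (Z.submatrix σ id)
    have hXσ := frobNorm_sub_le X (Y.submatrix σ id) (Z.submatrix σ id)
    rw [frobNorm_submatrix_sub] at hXσ
    rw [frobNorm_sub_comm Z Y] at hXY
    rw [frobNorm_sub_comm Z X] at hZσ
    linarith [asym_le hZ hσ]

end Orbits

section Variance

variable {l m n : ℕ}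

lemma sum_sum_sq_sub (x : Fin n → ℝ) (c : ℝ) :
    ∑ i, ∑ j, (x i - x j) ^ 2 = 2 * n * ∑ i, (x i - c) ^ 2 - 2 * (∑ i, (x i - c)) ^ 2 := by
  have hexp : ∀ i j, (x i - x j) ^ 2
      = (x i - c) ^ 2 + (x j - c) ^ 2 - 2 * ((x i - c) * (x j - c)) := fun i j => by ring
  simp only [hexp, Finset.sum_sub_distrib, Finset.sum_add_distrib, ← Finset.mul_sum,
    ← Finset.sum_mul, Finset.sum_const, Finset.card_univ, Fintype.card_fin, nsmul_eq_mul]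
  ring

lemma sum_frobNorm_sq (R : Fin n → Mat l m) :
    ∑ i, frobNorm (R i) ^ 2 = ∑ a, ∑ b, ∑ i, R i a b ^ 2 := by
  simp only [frobNorm_sq]
  rw [Finset.sum_comm]
  exact Finset.sum_congr rfl fun a _ => Finset.sum_comm

lemma sum_sum_frobNorm_sub_sq (R : Fin n → Mat l m) (W : Mat l m) :
    ∑ i, ∑ j, frobNorm (R i - R j) ^ 2
      = 2 * n * ∑ i, frobNorm (R i - W) ^ 2 - 2 * frobNorm (∑ i, (R i - W)) ^ 2 := by
  have hswap : ∑ i, ∑ j, frobNorm (R i - R j) ^ 2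
      = ∑ a, ∑ b, ∑ i, ∑ j, (R i a b - R j a b) ^ 2 := by
    simp only [sum_frobNorm_sq, Matrix.sub_apply]
    rw [Finset.sum_comm]
    exact Finset.sum_congr rfl fun a _ => Finset.sum_comm
  rw [hswap, sum_frobNorm_sq, frobNorm_sq]
  simp only [Finset.mul_sum, ← Finset.sum_sub_distrib, Matrix.sum_apply, Matrix.sub_apply]
  refine Finset.sum_congr rfl fun a _ => Finset.sum_congr rfl fun b _ => ?_
  rw [sum_sum_sq_sub (fun i => R i a b) (W a b), Finset.mul_sum]

lemma alignCost_le (hn : 0 < n) (R : Fin n → Mat l m) (W : Mat l m) :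
    alignCost R ≤ 2 * (1 / (n : ℝ) * ∑ i, frobNorm (R i - W) ^ 2) := by
  have hn' : (0 : ℝ) < n := Nat.cast_pos.2 hn
  rw [alignCost, sum_sum_frobNorm_sub_sq R W, one_div_mul_eq_div, div_le_iff₀ (by positivity)]
  have : 2 * (1 / (n : ℝ) * ∑ i, frobNorm (R i - W) ^ 2) * (n : ℝ) ^ 2
      = 2 * n * ∑ i, frobNorm (R i - W) ^ 2 := by field_simp
  rw [this]
  linarith [sq_nonneg (frobNorm (∑ i, (R i - W)))]

lemma alignCost_eq (hn : 0 < n) (R : Fin n → Mat l m) :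
    alignCost R = 2 * (1 / (n : ℝ) * ∑ i, frobNorm (R i - alignMean R) ^ 2) := by
  have hn' : (n : ℝ) ≠ 0 := Nat.cast_ne_zero.2 hn.ne'
  have hzero : ∑ i, (R i - alignMean R) = 0 := by
    simp [Finset.sum_sub_distrib, alignMean, ← Nat.cast_smul_eq_nsmul ℝ, smul_smul, hn']
  have hfrob : frobNorm (0 : Mat l m) = 0 := by simp [frobNorm]
  rw [alignCost, sum_sum_frobNorm_sub_sq R (alignMean R), hzero, hfrob]
  field_simp
  ring

lemma isLabeled_alignMean (hn : 0 < n) {R : Fin n → Mat l m} (hR : ∀ i, IsLabeled (R i)) :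
    IsLabeled (alignMean R) := by
  have hn' : (0 : ℝ) < n := Nat.cast_pos.2 hn
  have happ : ∀ a b, alignMean R a b = (n : ℝ)⁻¹ * ∑ i, R i a b := fun a b => by
    simp [alignMean, Matrix.sum_apply]
  refine ⟨fun a b => ?_, fun b => ?_⟩
  · rw [happ, inv_mul_le_iff₀ hn']
    refine ⟨mul_nonneg (by positivity) (Finset.sum_nonneg fun i _ => ((hR i).1 a b).1), ?_⟩
    simpa using Finset.sum_le_sum fun i (_ : i ∈ Finset.univ) => ((hR i).1 a b).2
  · simp only [happ, ← Finset.mul_sum]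
    rw [Finset.sum_comm]
    simp [(hR _).2 b, hn'.ne']

end Variance

/-- Let `Z` be an asymmetric partition with representation
`Z'`, and let `𝒮ₙ = (X₁, …, Xₙ)` be a sample of partitions contained in the
asymmetry ball `A_Z = {X ∈ 𝒫 : δ(X, Z) ≤ α_Z/4}`.  If for each `i` the
representation `Xᵢ' ∈ Xᵢ` is in optimal position with `Z'`, then the multiple
alignment `𝔛 = (X₁', …, Xₙ')` is an optimal multiple alignment of `𝒮ₙ`, the
partition `M = π((1/n) Σᵢ Xᵢ')` is a mean partition of `𝒮ₙ`, and `M ∈ A_Z`. -/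
theorem optimal_position_alignment_gives_mean (l m : ℕ) (hl : 1 ≤ l) (hm : 1 ≤ m)
    (n : ℕ) (hn : 0 < n)
    (Z : Set (Mat l m)) (hZ : Z ∈ PartitionSpace l m) (hasym : 0 < asym Z)
    (Z' : Mat l m) (hZ' : Z' ∈ Z)
    (s : Fin n → Set (Mat l m)) (hs : ∀ i, s i ∈ PartitionSpace l m)
    (hball : ∀ i, pdist (s i) Z ≤ asym Z / 4)
    (R : Fin n → Mat l m) (hR : ∀ i, R i ∈ s i)
    (hopt : ∀ i, frobNorm (R i - Z') = pdist (s i) Z) :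
    IsOptimalAlignment s R ∧
    IsMeanPartition s (orbit (alignMean R)) ∧
    pdist (orbit (alignMean R)) Z ≤ asym Z / 4 := by
  have hclose : ∀ i, frobNorm (R i - Z') ≤ asym Z / 4 := fun i => (hopt i).trans_le (hball i)
  have halign : IsOptimalAlignment s R := by
    refine ⟨hR, fun R' hR' => ?_⟩
    refine mul_le_mul_of_nonneg_left (Finset.sum_le_sum fun i _ => Finset.sum_le_sum fun j _ =>
      pow_le_pow_left₀ (frobNorm_nonneg _) ?_ 2) (by positivity)
    obtain ⟨σ, hσ⟩ := exists_submatrix_eq (hs i) (hR' i) (hR i)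
    obtain ⟨τ, hτ⟩ := exists_submatrix_eq (hs j) (hR j) (submatrix_mem (hs j) (hR' j) σ)
    rw [← frobNorm_submatrix_sub (R' i) (R' j) σ, ← hσ, hτ]
    exact frobNorm_sub_le_submatrix hZ' (hclose i) (hclose j) τ
  refine ⟨halign, ⟨⟨_, isLabeled_alignMean hn fun i => isLabeled_of_mem (hs i) (hR i), rfl⟩,
    fun W hW => ?_⟩, (pdist_le (mem_orbit_self _) hZ').trans
      (frobNorm_alignMean_sub_le hn R Z' hclose)⟩
  obtain ⟨W', hW'⟩ : W.Nonempty := by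
    obtain ⟨X, -, rfl⟩ := hW
    exact ⟨X, mem_orbit_self X⟩
  choose R' hR' hpos using fun i => exists_optimal_position (hs i) hW hW'
  have hmean : frechet s (orbit (alignMean R))
      ≤ 1 / (n : ℝ) * ∑ i, frobNorm (R i - alignMean R) ^ 2 :=
    mul_le_mul_of_nonneg_left (Finset.sum_le_sum fun i _ => pow_le_pow_left₀ (pdist_nonneg _ _)
      (pdist_le (hR i) (mem_orbit_self _)) 2) (by positivity)
  have hW_cost := alignCost_le hn R' W'
  simp only [hpos] at hW_cost
  rw [frechet] at hmean ⊢
  rw [frechet]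
  linarith [alignCost_eq hn R, halign.2 R' hR']

end CJT
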